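/- For a chi-squared random variable with k ≥ 2 degrees of freedom and any u ≥ k−1, P[χ²(k) ≥ u] ≥ ((1 − e^{−2})/2) · (1/√k) · (u/(u − k + 2√k)) · exp( −(1/2)( u − k − (k−2) ln(u/k) ) ). -/

import Mathlib

open MeasureTheory ProbabilityTheory

/-- The chi-squared distribution with `k` degrees of freedom, as the Gamma distribution with
shape `k/2` and rate `1/2`. -/
noncomputable def chiSqMeasure (k : ℕ) : Measure ℝ :=
  gammaMeasure ((k : ℝ) / 2) (1 / 2)

open Real Set Filter Topology

/-- One step of the induction for Stirling's upper bound: `x ^ (x - 1/2) * exp (-x)` grows by at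
least the factor `x` between `x` and `x + 1`. -/
lemma mul_rpow_sub_half_mul_exp_neg_le {x : ℝ} (hx : 0 < x) :
    x * (x ^ (x - 1 / 2) * exp (-x)) ≤ (x + 1) ^ (x + 1 - 1 / 2) * exp (-(x + 1)) := by
  have hlog : 1 ≤ (log (x + 1) - log x) * (x + 1 / 2) := by
    have h := le_log_one_add_of_nonneg (inv_pos.2 hx).le
    have e1 : 2 * x⁻¹ / (x⁻¹ + 2) = 1 / (x + 1 / 2) := by field_simp; ring
    have e2 : log (1 + x⁻¹) = log (x + 1) - log x := by
      rw [← log_div (by positivity) hx.ne']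
      congr 1
      field_simp
    rwa [e1, e2, div_le_iff₀ (by positivity)] at h
  rw [rpow_def_of_pos hx, rpow_def_of_pos (by positivity : 0 < x + 1)]
  nth_rewrite 1 [← exp_log hx]
  rw [← exp_add, ← exp_add, ← exp_add, exp_le_exp]
  linarith

/-- A Stirling-type upper bound for the Gamma function at positive half-integers. -/
lemma Gamma_half_nat_le (n : ℕ) (hn : 1 ≤ n) :
    Gamma ((n : ℝ) / 2) ≤ 3 * (((n : ℝ) / 2) ^ ((n : ℝ) / 2 - 1 / 2) * exp (-((n : ℝ) / 2))) := by
  induction n using Nat.strong_induction_on with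
  | _ n ih =>
    match n, hn with
    | 1, _ =>
      have h3 : √π ≤ 3 * exp (-(1 / 2)) := by
        rw [sqrt_le_left (by positivity), mul_pow, ← exp_nat_mul,
          show ((2 : ℕ) : ℝ) * -(1 / 2) = -1 by norm_num, exp_neg, ← div_eq_mul_inv,
          le_div_iff₀ (exp_pos 1)]
        nlinarith [exp_one_lt_d9, pi_lt_d2, pi_pos, exp_pos 1]
      rw [Nat.cast_one, Gamma_one_half_eq, sub_self, rpow_zero, one_mul]
      exact h3
    | 2, _ =>
      have h := exp_one_lt_three
      have h3 : 1 ≤ 3 * exp (-1) := by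
        rw [exp_neg, ← div_eq_mul_inv, le_div_iff₀ (exp_pos 1)]
        linarith
      simpa using h3
    | m + 3, _ =>
      have hx : (0 : ℝ) < ((m + 1 : ℕ) : ℝ) / 2 := by positivity
      have e : ((m + 3 : ℕ) : ℝ) / 2 = ((m + 1 : ℕ) : ℝ) / 2 + 1 := by push_cast; ring
      have h := ih (m + 1) (by omega) (by omega)
      rw [e, Gamma_add_one hx.ne']
      calc _ ≤ _ := mul_le_mul_of_nonneg_left h hx.le
        _ ≤ _ := by linarith [mul_rpow_sub_half_mul_exp_neg_le hx]

/-- Lower bound of Mills-ratio type for the upper tail of the Gamma distribution with shape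
`s ^ 2 / 2` and rate `1 / 2`: the tail at `u` is at least `2 * u / (u - s ^ 2 + 2 * s)` times the
density at `u`. -/
lemma ofReal_mul_density_le_gammaMeasure_Ici {s u : ℝ} (hs : 0 < s) (hs2 : 2 ≤ s ^ 2)
    (hu : s ^ 2 - 1 ≤ u) :
    ENNReal.ofReal ((1 / 2) ^ (s ^ 2 / 2) / Gamma (s ^ 2 / 2) *
      (2 * u ^ (s ^ 2 / 2) * exp (-(1 / 2) * u) / (u - s ^ 2 + 2 * s)))
      ≤ gammaMeasure (s ^ 2 / 2) (1 / 2) (Ici u) := by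
  have hs1 : 7 / 5 ≤ s := by nlinarith
  set c : ℝ := (1 / 2) ^ (s ^ 2 / 2) / Gamma (s ^ 2 / 2) with hc
  have hc0 : 0 < c := by positivity
  set q : ℝ → ℝ := fun x ↦
    ((x - s ^ 2) * (x - s ^ 2 + 2 * s) + 2 * x) / (x - s ^ 2 + 2 * s) ^ 2 with hq
  have hD : ∀ x ∈ Ici u, 0 < x - s ^ 2 + 2 * s := fun x hx ↦ by
    have : u ≤ x := hx
    linarith
  have hpos : ∀ x ∈ Ici u, 0 < x := fun x hx ↦ by
    have : u ≤ x := hx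
    linarith
  have hq0 : ∀ x ∈ Ici u, 0 ≤ q x := fun x hx ↦ by
    have hux : u ≤ x := hx
    refine div_nonneg ?_ (sq_nonneg _)
    obtain ⟨y, rfl⟩ : ∃ y, x = s ^ 2 - 1 + y := ⟨x - s ^ 2 + 1, by ring⟩
    have hy : 0 ≤ y := by linarith
    nlinarith [mul_nonneg hy hs.le, mul_nonneg hy hy]
  have hq1 : ∀ x ∈ Ici u, q x ≤ 1 := fun x hx ↦ by
    have hux : u ≤ x := hx
    have := hD x hx
    rw [hq, div_le_one (by positivity)]
    obtain ⟨y, rfl⟩ : ∃ y, x = s ^ 2 - 1 + y := ⟨x - s ^ 2 + 1, by ring⟩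
    have hy : 0 ≤ y := by linarith
    nlinarith [mul_nonneg hy (by linarith : 0 ≤ s - 7 / 5)]
  set G : ℝ → ℝ := fun x ↦
    c * (2 * x ^ (s ^ 2 / 2) * exp (-(1 / 2) * x) / (x - s ^ 2 + 2 * s)) with hG
  set p : ℝ → ℝ := fun x ↦ c * x ^ (s ^ 2 / 2 - 1) * exp (-(1 / 2 * x)) with hp
  have hp0 : ∀ x ∈ Ici u, 0 ≤ p x := fun x hx ↦ by
    have := hpos x hx
    positivity
  have hderiv : ∀ x ∈ Ici u, HasDerivAt G (-(p x * q x)) x := fun x hx ↦ by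
    have hx0 := hpos x hx
    have hDx := hD x hx
    have h1 := (hasDerivAt_rpow_const (p := s ^ 2 / 2) (Or.inl hx0.ne')).const_mul 2
    have h2 : HasDerivAt (fun x : ℝ ↦ exp (-(1 / 2) * x)) (exp (-(1 / 2) * x) * (-(1 / 2) * 1)) x :=
      ((hasDerivAt_id x).const_mul (-(1 / 2))).exp
    have h3 : HasDerivAt (fun x : ℝ ↦ x - s ^ 2 + 2 * s) 1 x :=
      ((hasDerivAt_id x).sub_const _).add_const _
    have h4 := ((h1.mul h2).div h3 hDx.ne').const_mul c
    refine h4.congr_deriv ?_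
    have e : x ^ (s ^ 2 / 2) = x ^ (s ^ 2 / 2 - 1) * x := by
      rw [← rpow_add_one hx0.ne', sub_add_cancel]
    simp only [hp, hq, Pi.mul_apply, e, ← neg_mul]
    field_simp
    ring
  have hlim : Tendsto G atTop (𝓝 0) := by
    have h1 := tendsto_rpow_mul_exp_neg_mul_atTop_nhds_zero (s ^ 2 / 2) (1 / 2) (by norm_num)
    have h2 : Tendsto (fun x : ℝ ↦ x - s ^ 2 + 2 * s) atTop atTop :=
      tendsto_atTop_add_const_right _ _ (tendsto_atTop_add_const_right _ _ tendsto_id)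
    have h3 := ((h1.const_mul 2).mul h2.inv_tendsto_atTop).const_mul c
    simp only [mul_zero] at h3
    refine h3.congr fun x ↦ ?_
    simp only [hG, Pi.inv_apply]
    ring
  have hneg : ∀ x ∈ Ioi u, -(p x * q x) ≤ 0 := fun x hx ↦
    neg_nonpos.2 (mul_nonneg (hp0 x (mem_Ici_of_Ioi hx)) (hq0 x (mem_Ici_of_Ioi hx)))
  have hint := (integrableOn_Ioi_deriv_of_nonpos' hderiv hneg hlim).neg
  have hval := integral_Ioi_of_hasDerivAt_of_nonpos' hderiv hneg hlim
  have hGu : G u = ∫ x in Ioi u, p x * q x := by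
    rw [integral_neg] at hval
    linarith
  have hint' : IntegrableOn (fun x ↦ p x * q x) (Ioi u) := by
    refine hint.congr_fun (fun x _ ↦ ?_) measurableSet_Ioi
    simp
  change ENNReal.ofReal (G u) ≤ _
  rw [hGu, ofReal_integral_eq_lintegral_ofReal hint'
    ((ae_restrict_iff' measurableSet_Ioi).2 (.of_forall fun x hx ↦ neg_nonpos.1 (hneg x hx))),
    gammaMeasure, withDensity_apply _ measurableSet_Ici,
    ← setLIntegral_congr (Ioi_ae_eq_Ici (a := u))]
  refine setLIntegral_mono' measurableSet_Ioi fun x hx ↦ ?_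
  have hx' : x ∈ Ici u := mem_Ici_of_Ioi hx
  rw [gammaPDF_of_nonneg (hpos x hx').le]
  exact ENNReal.ofReal_le_ofReal (mul_le_of_le_one_right (hp0 x hx') (hq1 x hx'))

/-- Lower bound, of order `1 / √k`, for the normalised chi-squared density at `k`. -/
lemma le_chiSq_density_mul (k : ℕ) (hk : 1 ≤ k) :
    (1 - exp (-2)) / 2 * (1 / √(k : ℝ)) ≤ 2 * ((1 / 2) ^ ((k : ℝ) / 2) / Gamma ((k : ℝ) / 2) *
      ((k : ℝ) ^ ((k : ℝ) / 2 - 1) * exp (-((k : ℝ) / 2)))) := by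
  have hk0 : (0 : ℝ) < k := by exact_mod_cast hk
  have hΓ : 0 < Gamma ((k : ℝ) / 2) := Gamma_pos_of_pos (by positivity)
  have hle := Gamma_half_nat_le k hk
  have hconst : (1 - exp (-2)) * √2 ≤ 4 / 3 := by
    have h1 : 1 / 9 ≤ exp (-2) := by
      rw [exp_neg, ← one_div]
      refine one_div_le_one_div_of_le (exp_pos 2) ?_
      rw [show (2 : ℝ) = 1 + 1 by norm_num, exp_add]
      nlinarith [exp_one_lt_three, exp_pos 1]
    have h2 : √2 ≤ 3 / 2 := by
      rw [sqrt_le_left (by norm_num)]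
      norm_num
    nlinarith [sqrt_nonneg (2 : ℝ)]
  have hident : (1 / 2 : ℝ) ^ ((k : ℝ) / 2) * ((k : ℝ) ^ ((k : ℝ) / 2 - 1)) * √(k : ℝ) * √2 =
      ((k : ℝ) / 2) ^ ((k : ℝ) / 2 - 1 / 2) := by
    rw [sqrt_eq_rpow, sqrt_eq_rpow, rpow_def_of_pos (by norm_num : (0 : ℝ) < 1 / 2),
      rpow_def_of_pos hk0, rpow_def_of_pos hk0, rpow_def_of_pos zero_lt_two,
      rpow_def_of_pos (by positivity : 0 < (k : ℝ) / 2), log_div hk0.ne' two_ne_zero,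
      log_div one_ne_zero two_ne_zero, log_one, ← exp_add, ← exp_add, ← exp_add]
    congr 1
    ring
  set A := (1 / 2 : ℝ) ^ ((k : ℝ) / 2)
  set B := (k : ℝ) ^ ((k : ℝ) / 2 - 1)
  set E := exp (-((k : ℝ) / 2))
  rw [← hident] at hle
  have hE : 0 < E := exp_pos _
  have hA : 0 < A := by positivity
  have hB : 0 < B := by positivity
  have hr : 0 < √(k : ℝ) := by positivity
  have h2 : √(2 : ℝ) * √2 = 2 := mul_self_sqrt zero_le_two
  rw [div_mul_div_comm, div_mul_eq_mul_div, ← mul_div_assoc,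
    div_le_div_iff₀ (by positivity) hΓ]
  have hm : 0 ≤ 1 - exp (-2) := by simp
  calc (1 - exp (-2)) * 1 * Gamma ((k : ℝ) / 2)
      ≤ (1 - exp (-2)) * 1 * (3 * (A * B * √(k : ℝ) * √2 * E)) := by gcongr
    _ = (1 - exp (-2)) * √2 * (3 * (A * B * √(k : ℝ) * E)) := by ring
    _ ≤ 4 / 3 * (3 * (A * B * √(k : ℝ) * E)) := by gcongr
    _ = _ := by ring

/-- Lower bound on the chi-squared upper tail: for `k ≥ 2` and `u ≥ k - 1`,
`P[χ²(k) ≥ u] ≥ ((1-e⁻²)/2)·(1/√k)·(u/(u-k+2√k))·exp(-(1/2)(u-k-(k-2)ln(u/k)))`. -/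
theorem stmt_12 (k : ℕ) (hk : 2 ≤ k) (u : ℝ) (hu : (k : ℝ) - 1 ≤ u) :
    ENNReal.ofReal ((1 - Real.exp (-2)) / 2 * (1 / Real.sqrt k) *
        (u / (u - k + 2 * Real.sqrt k)) *
        Real.exp (-(1/2) * (u - k - ((k : ℝ) - 2) * Real.log (u / k))))
      ≤ chiSqMeasure k {x | u ≤ x} := by
  have hk2 : (2 : ℝ) ≤ k := by exact_mod_cast hk
  have hk0 : (0 : ℝ) < k := by linarith
  have hu0 : 0 < u := by linarith
  have hsq : √(k : ℝ) ^ 2 = k := sq_sqrt hk0.le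
  have hs : 0 < √(k : ℝ) := by positivity
  have hD : 0 < u - k + 2 * √(k : ℝ) := by nlinarith
  have htail := ofReal_mul_density_le_gammaMeasure_Ici hs (hsq.symm ▸ hk2) (hsq.symm ▸ hu)
  rw [hsq] at htail
  refine le_trans (ENNReal.ofReal_le_ofReal ?_) htail
  have hexp : exp (-(1/2) * (u - k - ((k : ℝ) - 2) * log (u / k))) =
      u ^ ((k : ℝ) / 2 - 1) * exp (-(1 / 2) * u) *
        ((k : ℝ) ^ ((k : ℝ) / 2 - 1) * exp (-((k : ℝ) / 2)))⁻¹ := by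
    rw [rpow_def_of_pos hu0, rpow_def_of_pos hk0, log_div hu0.ne' hk0.ne', ← exp_add, ← exp_add,
      ← exp_neg, ← exp_add]
    congr 1
    ring
  have hupow : u ^ ((k : ℝ) / 2) = u ^ ((k : ℝ) / 2 - 1) * u := by
    rw [← rpow_add_one hu0.ne', sub_add_cancel]
  have hN := le_chiSq_density_mul k (by omega)
  rw [hexp, hupow]
  set M := (k : ℝ) ^ ((k : ℝ) / 2 - 1) * exp (-((k : ℝ) / 2))
  have hM : 0 < M := by positivity
  refine (mul_le_mul_of_nonneg_right (mul_le_mul_of_nonneg_right hN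
    (by positivity)) (by positivity)).trans_eq ?_
  field_simp
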